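/- Let K be a symmetric convex body in ℝ^n and let r, r₁ > 0. Define K_r = K ∩ rD_n and K^{r₁} = co(K ∪ r₁D_n). Then (i) N_{K_r} ≤ max{3^n · N_K², 9^n · N_K}, and (ii) N_{K^{r₁}} ≤ 5^n · N_K. -/

import Mathlib

open MeasureTheory Metric Set
open scoped Pointwise

noncomputable section

/-- A symmetric convex body in `ℝ^n`: compact, convex, with nonempty interior
and symmetric about the origin. -/
def IsSymmetricConvexBody {n : ℕ} (K : Set (EuclideanSpace ℝ (Fin n))) : Prop :=
  Convex ℝ K ∧ IsCompact K ∧ (interior K).Nonempty ∧ K = -K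

/-- The covering number `N(K, L)`: the smallest `N` such that `K` can be covered by
`N` translates of `L`. -/
def coveringNumber {n : ℕ} (K L : Set (EuclideanSpace ℝ (Fin n))) : ℕ :=
  sInf {N : ℕ | ∃ t : Finset (EuclideanSpace ℝ (Fin n)), t.card = N ∧
    K ⊆ ⋃ x ∈ t, x +ᵥ L}

/-- The volume radius `λ_K = (|K|/|D_n|)^{1/n}`. -/
def volRadius {n : ℕ} (K : Set (EuclideanSpace ℝ (Fin n))) : ℝ :=
  ((volume K).toReal /
    (volume (closedBall (0 : EuclideanSpace ℝ (Fin n)) 1)).toReal) ^ ((1 : ℝ) / n)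

/-- `N_K = N(K, λ_K D_n)`. -/
def NcovK {n : ℕ} (K : Set (EuclideanSpace ℝ (Fin n))) : ℕ :=
  coveringNumber K (volRadius K • closedBall 0 1)

open scoped ENNReal

lemma bm_one_aux {A B C : Set ℝ} (hA : IsCompact A) (hB : IsCompact B) (hAn : A.Nonempty)
    (hBn : B.Nonempty) (hC : ∀ x ∈ A, ∀ y ∈ B, x + y ∈ C) :
    volume A + volume B ≤ volume C := by
  obtain ⟨a, haA, ha⟩ := hA.exists_isGreatest hAn
  obtain ⟨b, hbB, hb⟩ := hB.exists_isLeast hBn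
  have h1 : volume ((fun x => x + b) '' A) = volume A := by
    simp [Set.image_add_right, measure_preimage_add_right]
  have h2 : volume ((fun x => a + x) '' B) = volume B := by
    simp [Set.image_add_left, measure_preimage_add]
  have h3 : MeasurableSet ((fun x => a + x) '' B) :=
    (hB.image (by fun_prop)).measurableSet
  have hd : AEDisjoint volume ((fun x => x + b) '' A) ((fun x => a + x) '' B) := by
    refine measure_mono_null (t := {a + b}) ?_ (by simp)
    rintro z ⟨⟨x, hx, rfl⟩, ⟨y, hy, hxy⟩⟩
    have := ha hx
    have := hb hy
    simp only [mem_singleton_iff] at *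
    linarith
  rw [← h1, ← h2, ← measure_union₀ h3.nullMeasurableSet hd]
  apply measure_mono
  rintro z (⟨x, hx, rfl⟩ | ⟨y, hy, rfl⟩)
  · exact hC _ hx _ hbB
  · exact hC _ haA _ hy

lemma bm_one {A B C : Set ℝ} (hA : MeasurableSet A) (hB : MeasurableSet B) (hAn : A.Nonempty)
    (hBn : B.Nonempty) (hC : ∀ x ∈ A, ∀ y ∈ B, (x + y) / 2 ∈ C) :
    volume A + volume B ≤ 2 * volume C := by
  obtain ⟨a, ha⟩ := hAn
  obtain ⟨b, hb⟩ := hBn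
  have hvol : volume ((fun x : ℝ => (2⁻¹ : ℝ) * x) ⁻¹' C) = 2 * volume C := by
    rw [Real.volume_preimage_mul_left (by norm_num)]
    simp
  rw [← hvol, hA.measure_eq_iSup_isCompact, hB.measure_eq_iSup_isCompact]
  simp only [iSup_and', ]
  refine ENNReal.biSup_add_biSup_le' (p := fun K => K ⊆ A ∧ IsCompact K)
    (q := fun K => K ⊆ B ∧ IsCompact K) ⟨∅, by simp⟩ ⟨∅, by simp⟩ ?_
  rintro K ⟨hKA, hK⟩ L ⟨hLB, hL⟩
  calc volume K + volume L ≤ volume (insert a K) + volume (insert b L) := by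
        gcongr <;> simp
    _ ≤ _ := by
      apply bm_one_aux (hK.insert a) (hL.insert b) (by simp) (by simp)
      intro x hx y hy
      have hx' : x ∈ A := by rcases hx with rfl | hx; exacts [ha, hKA hx]
      have hy' : y ∈ B := by rcases hy with rfl | hy; exacts [hb, hLB hy]
      have := hC x hx' y hy'
      simp only [mem_preimage]
      convert this using 1
      ring

lemma pl_one_real {f g h : ℝ → ℝ} (hf : Measurable f) (hg : Measurable g) (hh : Measurable h)
    (hf0 : ∀ x, 0 ≤ f x) (hg0 : ∀ x, 0 ≤ g x) (hh0 : ∀ x, 0 ≤ h x)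
    (hf1 : ∀ x, f x ≤ 1) (hg1 : ∀ x, g x ≤ 1)
    (hfs : ∀ u < 1, ∃ x, u < f x) (hgs : ∀ u < 1, ∃ x, u < g x)
    (H : ∀ x y, min (f x) (g y) ≤ h ((x + y) / 2)) :
    (∫⁻ x, ENNReal.ofReal (f x)) + (∫⁻ x, ENNReal.ofReal (g x)) ≤
      2 * ∫⁻ x, ENNReal.ofReal (h x) := by
  have mono : ∀ k : ℝ → ℝ, Measurable (fun t : ℝ => volume {a : ℝ | t < k a}) := by
    intro k
    apply Antitone.measurable
    intro s t hst
    exact measure_mono fun x hx => lt_of_le_of_lt hst hx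
  rw [lintegral_eq_lintegral_meas_lt _ (.of_forall hf0) hf.aemeasurable,
    lintegral_eq_lintegral_meas_lt _ (.of_forall hg0) hg.aemeasurable,
    lintegral_eq_lintegral_meas_lt _ (.of_forall hh0) hh.aemeasurable,
    ← lintegral_add_left (mono f), ← lintegral_const_mul _ (mono h)]
  apply lintegral_mono
  intro t
  dsimp only
  by_cases ht : t < 1
  · apply bm_one (measurableSet_lt measurable_const hf) (measurableSet_lt measurable_const hg)
      (hfs t ht) (hgs t ht)
    intro x hx y hy
    exact lt_of_lt_of_le (lt_min hx hy) (H x y)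
  · have e1 : {a : ℝ | t < f a} = ∅ := by
      ext x; simp only [mem_ofPred_eq, mem_empty_iff_false, iff_false]
      have := hf1 x; linarith
    have e2 : {a : ℝ | t < g a} = ∅ := by
      ext x; simp only [mem_ofPred_eq, mem_empty_iff_false, iff_false]
      have := hg1 x; linarith
    simp [e1, e2]

lemma pl_one_norm {f g h : ℝ → ℝ≥0∞} (hf : Measurable f) (hg : Measurable g) (hh : Measurable h)
    (hf1 : ⨆ x, f x = 1) (hg1 : ⨆ x, g x = 1)
    (H : ∀ x y, min (f x) (g y) ≤ h ((x + y) / 2)) :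
    (∫⁻ x, f x) + (∫⁻ x, g x) ≤ 2 * ∫⁻ x, h x := by
  have key : ∀ k : ℝ → ℝ≥0∞, (⨆ x, k x = 1) → (∀ x, k x ≤ 1) ∧
      ∀ u < (1:ℝ), ∃ x, u < (k x).toReal := by
    intro k hk
    have h1 : ∀ x, k x ≤ 1 := fun x => hk ▸ le_iSup k x
    refine ⟨h1, fun u hu => ?_⟩
    have : ENNReal.ofReal u < ⨆ x, k x := by
      rw [hk]; simpa using hu
    obtain ⟨x, hx⟩ := lt_iSup_iff.1 this
    refine ⟨x, ?_⟩
    rcases lt_or_ge u 0 with h0 | h0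
    · exact h0.trans_le ENNReal.toReal_nonneg
    exact (ENNReal.ofReal_lt_iff_lt_toReal h0 ((h1 x).trans_lt ENNReal.one_lt_top).ne).1 hx
  obtain ⟨f1, fs⟩ := key f hf1
  obtain ⟨g1, gs⟩ := key g hg1
  have ft : ∀ x, f x ≠ ⊤ := fun x => ((f1 x).trans_lt ENNReal.one_lt_top).ne
  have gt : ∀ x, g x ≠ ⊤ := fun x => ((g1 x).trans_lt ENNReal.one_lt_top).ne
  have ht : ∀ x, min (h x) 1 ≠ ⊤ := fun x => ((min_le_right _ _).trans_lt ENNReal.one_lt_top).ne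
  have := pl_one_real (f := fun x => (f x).toReal) (g := fun x => (g x).toReal)
    (h := fun x => (min (h x) 1).toReal) hf.ennreal_toReal hg.ennreal_toReal
    (hh.min measurable_const).ennreal_toReal (fun _ => ENNReal.toReal_nonneg)
    (fun _ => ENNReal.toReal_nonneg) (fun _ => ENNReal.toReal_nonneg)
    (fun x => ENNReal.toReal_le_of_le_ofReal zero_le_one (by simpa using f1 x))
    (fun x => ENNReal.toReal_le_of_le_ofReal zero_le_one (by simpa using g1 x)) fs gs (by
      intro x y
      rw [← ENNReal.toReal_min (ft x) (gt y)]
      exact ENNReal.toReal_mono (ht _) (le_min (H x y) ((min_le_left _ _).trans (f1 x))))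
  simp only [ENNReal.ofReal_toReal (ft _), ENNReal.ofReal_toReal (gt _),
    ENNReal.ofReal_toReal (ht _)] at this
  refine this.trans ?_
  gcongr
  exact min_le_left _ _

lemma ennreal_amgm (a b c : ℝ≥0∞) (h : a + b ≤ 2 * c) : a * b ≤ c ^ 2 := by
  by_cases hc : c = ⊤
  · simp [hc]
  have hab : a + b ≠ ⊤ := (h.trans_lt (ENNReal.mul_lt_top (by simp) (lt_top_iff_ne_top.2 hc))).ne
  rw [ENNReal.add_ne_top] at hab
  lift a to NNReal using hab.1
  lift b to NNReal using hab.2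
  lift c to NNReal using hc
  norm_cast at *
  rw [← NNReal.coe_le_coe] at *
  push_cast at *
  nlinarith [sq_nonneg ((a:ℝ) - b), a.2, b.2, c.2]

lemma pl_one_bdd {f g h : ℝ → ℝ≥0∞} (hf : Measurable f) (hg : Measurable g) (hh : Measurable h)
    (hfb : ⨆ x, f x ≠ ⊤) (hgb : ⨆ x, g x ≠ ⊤)
    (H : ∀ x y, f x * g y ≤ h ((x + y) / 2) ^ 2) :
    (∫⁻ x, f x) * (∫⁻ x, g x) ≤ (∫⁻ x, h x) ^ 2 := by
  set F := ⨆ x, f x with hF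
  set G := ⨆ x, g x with hG
  by_cases hF0 : F = 0
  · have : ∀ x, f x = 0 := fun x => le_antisymm (hF0 ▸ le_iSup f x) bot_le
    simp [this]
  by_cases hG0 : G = 0
  · have : ∀ x, g x = 0 := fun x => le_antisymm (hG0 ▸ le_iSup g x) bot_le
    simp [this]
  set c : ℝ≥0∞ := (F * G) ^ (1/2 : ℝ) with hc
  have hFG : F * G ≠ 0 := mul_ne_zero hF0 hG0
  have hFG' : F * G ≠ ⊤ := ENNReal.mul_ne_top hfb hgb
  have hc2 : c ^ 2 = F * G := by
    rw [hc, ← ENNReal.rpow_natCast, ← ENNReal.rpow_mul]; simp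
  have hc0 : c ≠ 0 := fun h => hFG (by rw [← hc2, h]; simp)
  have hct : c ≠ ⊤ := fun h => hFG' (by rw [← hc2, h]; simp)
  have inv2 : F⁻¹ * G⁻¹ = c⁻¹ ^ 2 := by
    rw [← ENNReal.inv_pow, hc2, ENNReal.mul_inv (.inl hF0) (.inl hfb)]
  have := pl_one_norm (f := fun x => F⁻¹ * f x) (g := fun x => G⁻¹ * g x)
    (h := fun x => c⁻¹ * h x) (hf.const_mul _) (hg.const_mul _) (hh.const_mul _)
    (by rw [← ENNReal.mul_iSup]; exact ENNReal.inv_mul_cancel hF0 hfb)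
    (by rw [← ENNReal.mul_iSup]; exact ENNReal.inv_mul_cancel hG0 hgb) (by
      intro x y
      rw [← ENNReal.pow_le_pow_left_iff (n := 2) (by norm_num)]
      calc (min (F⁻¹ * f x) (G⁻¹ * g y)) ^ 2 ≤ (F⁻¹ * f x) * (G⁻¹ * g y) := by
            rw [sq]; exact mul_le_mul' (min_le_left _ _) (min_le_right _ _)
        _ = (F⁻¹ * G⁻¹) * (f x * g y) := by ring
        _ ≤ c⁻¹ ^ 2 * h ((x + y) / 2) ^ 2 := by rw [inv2]; gcongr; exact H x y
        _ = _ := by ring)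
  have := ennreal_amgm _ _ _ this
  rw [lintegral_const_mul _ hf, lintegral_const_mul _ hg, lintegral_const_mul _ hh, mul_pow,
    ← inv2] at this
  have h2 : (F⁻¹ * G⁻¹) * ((∫⁻ x, f x) * (∫⁻ x, g x)) ≤ (F⁻¹ * G⁻¹) * (∫⁻ x, h x) ^ 2 := by
    refine le_trans (le_of_eq ?_) this; ring
  refine (ENNReal.mul_le_mul_iff_right ?_ ?_).1 h2
  · rw [inv2]; simp [hct]
  · rw [inv2]; simp [hc0]

lemma pl_one {f g h : ℝ → ℝ≥0∞} (hf : Measurable f) (hg : Measurable g) (hh : Measurable h)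
    (H : ∀ x y, f x * g y ≤ h ((x + y) / 2) ^ 2) :
    (∫⁻ x, f x) * (∫⁻ x, g x) ≤ (∫⁻ x, h x) ^ 2 := by
  have key : ∀ k : ℝ → ℝ≥0∞, Measurable k → ∫⁻ x, k x = ⨆ m : ℕ, ∫⁻ x, min (k x) m := by
    intro k hk
    rw [← lintegral_iSup (fun m => hk.min measurable_const)]
    · congr 1
      ext x
      rw [← inf_iSup_eq, ENNReal.iSup_natCast, inf_top_eq]
    · intro i j hij x
      exact min_le_min le_rfl (by exact_mod_cast hij)
  rw [key f hf, key g hg, ENNReal.iSup_mul]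
  refine iSup_le fun i => ?_
  rw [ENNReal.mul_iSup]
  refine iSup_le fun j => ?_
  refine pl_one_bdd (hf.min measurable_const) (hg.min measurable_const) hh ?_ ?_ ?_
  · exact ((iSup_le fun x => min_le_right _ _).trans_lt (ENNReal.natCast_lt_top i)).ne
  · exact ((iSup_le fun x => min_le_right _ _).trans_lt (ENNReal.natCast_lt_top j)).ne
  · intro x y
    exact (mul_le_mul' (min_le_left _ _) (min_le_left _ _)).trans (H x y)

lemma pl_n (n : ℕ) : ∀ {f g h : (Fin n → ℝ) → ℝ≥0∞}, Measurable f → Measurable g → Measurable h →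
    (∀ x y, f x * g y ≤ h ((2⁻¹ : ℝ) • (x + y)) ^ 2) →
    (∫⁻ x, f x) * (∫⁻ x, g x) ≤ (∫⁻ x, h x) ^ 2 := by
  induction n with
  | zero =>
    intro f g h hf hg hh H
    have := H default default
    rw [Subsingleton.elim ((2⁻¹ : ℝ) • (default + default : Fin 0 → ℝ)) default] at this
    rw [volume_pi, Measure.pi_of_empty _ default]
    simpa [lintegral_dirac] using this
  | succ n ih =>
    intro f g h hf hg hh H
    let e := (MeasurableEquiv.piFinSuccAbove (fun _ : Fin (n+1) => ℝ) 0).symm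
    have he : MeasurePreserving e := 
      (volume_preserving_piFinSuccAbove (fun _ : Fin (n + 1) => ℝ) 0).symm _
    have key : ∀ k : (Fin (n+1) → ℝ) → ℝ≥0∞, Measurable k →
        ∫⁻ x, k x = ∫⁻ t : ℝ, ∫⁻ y : Fin n → ℝ, k (e (t, y)) := by
      intro k hk
      rw [← he.lintegral_comp hk, Measure.volume_eq_prod,
        lintegral_prod (fun z => k (e z)) (hk.comp e.measurable).aemeasurable]
    have m : ∀ k : (Fin (n+1) → ℝ) → ℝ≥0∞, Measurable k →
        Measurable (fun t : ℝ => ∫⁻ y : Fin n → ℝ, k (e (t, y))) := fun k hk =>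
      (hk.comp e.measurable).lintegral_prod_right'
    rw [key f hf, key g hg, key h hh]
    refine pl_one (m f hf) (m g hg) (m h hh) ?_
    intro s t
    have mm : ∀ t, Measurable fun y : Fin n → ℝ => e (t, y) := fun t =>
      e.measurable.comp measurable_prodMk_left
    refine ih (hf.comp (mm s)) (hg.comp (mm t)) (hh.comp (mm _)) ?_
    intro x y
    refine (H (e (s, x)) (e (t, y))).trans (le_of_eq ?_)
    congr 2
    simp only [e]
    ext i
    refine Fin.cases ?_ (fun i => ?_) i
    · simp [MeasurableEquiv.piFinSuccAbove]; ring
    · simp [MeasurableEquiv.piFinSuccAbove]; ring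

lemma bm_symm {n : ℕ} {A B : Set (EuclideanSpace ℝ (Fin n))} (hA : MeasurableSet A)
    (hB : MeasurableSet B) (H : ∀ x ∈ A, ∀ y ∈ A, (2⁻¹ : ℝ) • (x - y) ∈ B) :
    volume A ≤ volume B := by
  let e := MeasurableEquiv.toLp 2 (Fin n → ℝ)
  have he : MeasurePreserving e := PiLp.volume_preserving_toLp (Fin n)
  have key : ∀ C : Set (EuclideanSpace ℝ (Fin n)), MeasurableSet C →
      volume C = ∫⁻ x, (C.indicator 1 : _ → ℝ≥0∞) (e x) := by
    intro C hC
    rw [he.lintegral_comp (measurable_one.indicator hC), lintegral_indicator_one hC]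
  have m : ∀ C : Set (EuclideanSpace ℝ (Fin n)), MeasurableSet C →
      Measurable fun x => (C.indicator 1 : _ → ℝ≥0∞) (e x) :=
    fun C hC => (measurable_one.indicator hC).comp e.measurable
  have hAn : volume (-A) = volume A := Measure.measure_neg _ _
  have := pl_n n (m A hA) (m _ hA.neg) (m B hB) (by
    intro x y
    by_cases h1 : e x ∈ A
    · by_cases h2 : e y ∈ -A
      · have : e ((2⁻¹ : ℝ) • (x + y)) ∈ B := by
          have := H _ h1 _ h2
          rw [sub_neg_eq_add] at this
          exact this
        rw [indicator_of_mem h1, indicator_of_mem h2, indicator_of_mem this]; simp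
      · rw [indicator_of_notMem h2]; simp
    · rw [indicator_of_notMem h1]; simp)
  rw [← key A hA, ← key _ hA.neg, ← key B hB, hAn, ← sq] at this
  exact (ENNReal.pow_le_pow_left_iff (n := 2) (by norm_num)).1 this

lemma vadd_smul_ball {n : ℕ} (x : EuclideanSpace ℝ (Fin n)) {m : ℝ} (hm : 0 ≤ m) :
    x +ᵥ m • closedBall (0 : EuclideanSpace ℝ (Fin n)) 1 = closedBall x m := by
  rw [smul_unitClosedBall_of_nonneg hm, vadd_closedBall]; simp

lemma vol_cball {n : ℕ} (x : EuclideanSpace ℝ (Fin n)) {m : ℝ} (hm : 0 ≤ m) :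
    volume.real (closedBall x m) =
      m ^ n * volume.real (closedBall (0 : EuclideanSpace ℝ (Fin n)) 1) := by
  rw [measureReal_def, measureReal_def, Measure.addHaar_closedBall' _ _ hm]
  simp [ENNReal.toReal_mul, ENNReal.toReal_ofReal (pow_nonneg hm n)]

lemma vol_unit_pos {n : ℕ} :
    0 < volume.real (closedBall (0 : EuclideanSpace ℝ (Fin n)) 1) :=
  ENNReal.toReal_pos (measure_closedBall_pos _ _ zero_lt_one).ne' measure_closedBall_lt_top.ne

lemma separated_card {n : ℕ} {s m : ℝ} (hs : 0 ≤ s) (hm : 0 < m)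
    (t : Finset (EuclideanSpace ℝ (Fin n))) (ht : ∀ x ∈ t, x ∈ closedBall 0 s)
    (hsep : ∀ x ∈ t, ∀ y ∈ t, x ≠ y → m < dist x y) :
    (t.card : ℝ) ≤ (1 + 2 * s / m) ^ n := by
  have hd : Set.PairwiseDisjoint (t : Set (EuclideanSpace ℝ (Fin n)))
      (fun c => closedBall c (m / 2)) := by
    intro x hx y hy hxy
    apply closedBall_disjoint_closedBall
    have := hsep x hx y hy hxy
    linarith
  have hsub : (⋃ x ∈ t, closedBall x (m / 2)) ⊆
      closedBall (0 : EuclideanSpace ℝ (Fin n)) (s + m / 2) := by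
    refine iUnion₂_subset fun x hx => closedBall_subset_closedBall' ?_
    have := mem_closedBall.1 (ht x hx)
    linarith
  have h1 := measureReal_mono (μ := volume) hsub measure_closedBall_lt_top.ne
  rw [measureReal_biUnion_finset hd (fun _ _ => measurableSet_closedBall)
    (fun _ _ => measure_closedBall_lt_top.ne)] at h1
  rw [vol_cball _ (show 0 ≤ s + m / 2 by positivity)] at h1
  simp only [vol_cball _ (show 0 ≤ m / 2 by positivity),
    Finset.sum_const, nsmul_eq_mul, ← mul_assoc] at h1
  have h2 := le_of_mul_le_mul_right h1 vol_unit_pos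
  have h3 : (s + m / 2) = (1 + 2 * s / m) * (m / 2) := by field_simp; ring
  rw [h3, mul_pow] at h2
  exact le_of_mul_le_mul_right h2 (by positivity)

lemma ball_cover {n : ℕ} {s m : ℝ} (hs : 0 ≤ s) (hm : 0 < m) :
    ∃ t : Finset (EuclideanSpace ℝ (Fin n)), (t.card : ℝ) ≤ (1 + 2 * s / m) ^ n ∧
      closedBall 0 s ⊆ ⋃ x ∈ t, closedBall x m := by
  classical
  let P : ℕ → Prop := fun k => ∃ t : Finset (EuclideanSpace ℝ (Fin n)), t.card = k ∧
    (∀ x ∈ t, x ∈ closedBall 0 s) ∧ (∀ x ∈ t, ∀ y ∈ t, x ≠ y → m < dist x y)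
  have hP : ∀ k, P k → k ≤ ⌊(1 + 2 * s / m) ^ n⌋₊ := by
    rintro k ⟨t, rfl, h1, h2⟩
    exact Nat.le_floor (separated_card hs hm t h1 h2)
  have h0 : P 0 := ⟨∅, by simp⟩
  obtain ⟨t, htc, h1, h2⟩ := Nat.findGreatest_spec (P := P) (Nat.zero_le ⌊(1 + 2 * s / m) ^ n⌋₊) h0
  refine ⟨t, separated_card hs hm t h1 h2, fun z hz => ?_⟩
  by_contra hz'
  simp only [mem_iUnion, mem_closedBall, not_exists, not_le] at hz'
  have hzt : z ∉ t := fun h => by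
    have := hz' z h
    simp at this; linarith
  have : P (t.card + 1) := by
    refine ⟨insert z t, Finset.card_insert_of_notMem hzt, ?_, ?_⟩
    · intro x hx
      rcases Finset.mem_insert.1 hx with rfl | hx
      exacts [hz, h1 x hx]
    · intro x hx y hy hxy
      rcases Finset.mem_insert.1 hx with rfl | hx2
      · rcases Finset.mem_insert.1 hy with rfl | hy
        · exact absurd rfl hxy
        · exact hz' y hy
      · rcases Finset.mem_insert.1 hy with rfl | hy
        · rw [dist_comm]; exact hz' x hx2
        · exact h2 x hx2 y hy hxy
  have := Nat.le_findGreatest (hP _ this) this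
  omega

lemma cov_le {n : ℕ} {s m : ℝ} (hs : 0 ≤ s) (hm : 0 < m) {A : Set (EuclideanSpace ℝ (Fin n))}
    (t : Finset (EuclideanSpace ℝ (Fin n))) (hA : A ⊆ ⋃ x ∈ t, closedBall x s) :
    (coveringNumber A (m • closedBall 0 1) : ℝ) ≤ t.card * (1 + 2 * s / m) ^ n := by
  classical
  obtain ⟨u, hu, hc⟩ := ball_cover (n := n) hs hm
  have h1 : coveringNumber A (m • closedBall 0 1) ≤ (t + u).card := by
    refine Nat.sInf_le ⟨t + u, rfl, ?_⟩
    intro z hz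
    simp only [vadd_smul_ball _ hm.le, mem_iUnion, exists_prop]
    obtain ⟨x, hx, hzx⟩ := mem_iUnion₂.1 (hA hz)
    have : z - x ∈ closedBall (0 : EuclideanSpace ℝ (Fin n)) s := by
      simpa [dist_eq_norm] using hzx
    obtain ⟨y, hy, hzy⟩ := mem_iUnion₂.1 (hc this)
    refine ⟨x + y, Finset.add_mem_add hx hy, ?_⟩
    rw [mem_closedBall, dist_eq_norm] at hzy ⊢
    rwa [← sub_sub]
  calc (coveringNumber A (m • closedBall 0 1) : ℝ) ≤ ((t + u).card : ℝ) := by exact_mod_cast h1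
    _ ≤ ((t.card * u.card : ℕ) : ℝ) := by exact_mod_cast Finset.card_add_le
    _ = t.card * u.card := by push_cast; rfl
    _ ≤ _ := by gcongr

lemma cov_attained {n : ℕ} {K : Set (EuclideanSpace ℝ (Fin n))} (hK : IsCompact K)
    (hv : 0 < volRadius K) : ∃ t : Finset (EuclideanSpace ℝ (Fin n)), t.card = NcovK K ∧
      K ⊆ ⋃ x ∈ t, closedBall x (volRadius K) := by
  have hne : {N : ℕ | ∃ t : Finset (EuclideanSpace ℝ (Fin n)), t.card = N ∧
    K ⊆ ⋃ x ∈ t, x +ᵥ (volRadius K • closedBall (0 : EuclideanSpace ℝ (Fin n)) 1)}.Nonempty := by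
    obtain ⟨t, -, htf, ht⟩ := hK.finite_cover_balls hv
    refine ⟨_, htf.toFinset, rfl, ht.trans ?_⟩
    simp only [Finite.mem_toFinset, vadd_smul_ball _ hv.le]
    exact iUnion₂_mono fun x _ => ball_subset_closedBall
  obtain ⟨t, h1, h2⟩ := Nat.sInf_mem hne
  refine ⟨t, h1, ?_⟩
  simpa only [vadd_smul_ball _ hv.le] using h2

lemma Ncov_pos {n : ℕ} {K : Set (EuclideanSpace ℝ (Fin n))} (hK : IsCompact K)
    (hn : K.Nonempty) (hv : 0 < volRadius K) : 1 ≤ NcovK K := by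
  obtain ⟨t, h1, h2⟩ := cov_attained hK hv
  obtain ⟨z, hz⟩ := hn
  obtain ⟨x, hx, -⟩ := mem_iUnion₂.1 (h2 hz)
  rw [← h1]
  exact Finset.card_pos.2 ⟨x, hx⟩

lemma volRadius_pow {n : ℕ} (hn : n ≠ 0) (A : Set (EuclideanSpace ℝ (Fin n))) :
    0 ≤ volRadius A ∧ volume.real A =
      volRadius A ^ n * volume.real (closedBall (0 : EuclideanSpace ℝ (Fin n)) 1) := by
  have hV := vol_unit_pos (n := n)
  have h0 : 0 ≤ volume.real A / volume.real (closedBall (0 : EuclideanSpace ℝ (Fin n)) 1) := by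
    positivity
  refine ⟨Real.rpow_nonneg h0 _, ?_⟩
  have : volRadius A ^ n =
      volume.real A / volume.real (closedBall (0 : EuclideanSpace ℝ (Fin n)) 1) := by
    change ((volume.real A / volume.real (closedBall (0 : EuclideanSpace ℝ (Fin n)) 1)) ^
      ((1 : ℝ) / n)) ^ n = _
    rw [one_div, Real.rpow_inv_natCast_pow h0 hn]
  rw [this]
  field_simp

lemma volRadius_pos {n : ℕ} (hn : n ≠ 0) {A : Set (EuclideanSpace ℝ (Fin n))}
    (h : 0 < volume.real A) : 0 < volRadius A := by
  obtain ⟨h1, h2⟩ := volRadius_pow hn A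
  refine lt_of_le_of_ne h1 fun h0 => ?_
  rw [h2, ← h0, zero_pow hn] at h
  simp at h

lemma volRadius_mono {n : ℕ} (hn : n ≠ 0) {A B : Set (EuclideanSpace ℝ (Fin n))}
    (h : A ⊆ B) (hB : volume B ≠ ⊤) : volRadius A ≤ volRadius B := by
  obtain ⟨h1, h2⟩ := volRadius_pow hn A
  obtain ⟨h3, h4⟩ := volRadius_pow hn B
  have := measureReal_mono h hB
  rw [h2, h4] at this
  exact le_of_pow_le_pow_left₀ hn h3 (le_of_mul_le_mul_right this vol_unit_pos)

lemma volRadius_ball {n : ℕ} (hn : n ≠ 0) {r : ℝ} (hr : 0 ≤ r) :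
    volRadius (closedBall (0 : EuclideanSpace ℝ (Fin n)) r) = r := by
  obtain ⟨h3, h4⟩ := volRadius_pow hn (closedBall (0 : EuclideanSpace ℝ (Fin n)) r)
  rw [vol_cball _ hr] at h4
  exact ((pow_left_inj₀ hr h3 hn).1 (mul_right_cancel₀ vol_unit_pos.ne' h4)).symm

lemma inter_vol {n : ℕ} {K : Set (EuclideanSpace ℝ (Fin n))}
    (hc : Convex ℝ K) (hK : IsCompact K) (h0 : (0 : EuclideanSpace ℝ (Fin n)) ∈ K)
    (hs : K = -K) {l ρ : ℝ} (hl : 0 < l) (hρ : 0 < ρ) (hρl : ρ ≤ l)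
    (t : Finset (EuclideanSpace ℝ (Fin n))) (ht : K ⊆ ⋃ x ∈ t, closedBall x l) :
    (ρ / l) ^ n * volume.real K ≤ t.card * volume.real (K ∩ closedBall 0 ρ) := by
  have hfin : ∀ A, volume (K ∩ A) ≠ ⊤ := fun A =>
    ((measure_mono inter_subset_left).trans_lt hK.measure_lt_top).ne
  have h1 : ∀ x ∈ t, volume.real (K ∩ closedBall x l) ≤ volume.real (K ∩ closedBall 0 l) := by
    intro x _
    refine ENNReal.toReal_mono (hfin _) (bm_symm (hK.measurableSet.inter measurableSet_closedBall)
      (hK.measurableSet.inter measurableSet_closedBall) ?_)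
    rintro a ⟨ha, ha'⟩ b ⟨hb, hb'⟩
    constructor
    · have hb2 : -b ∈ K := by rw [hs]; simpa using hb
      have := hc ha hb2 (a := (2⁻¹ : ℝ)) (b := (2⁻¹ : ℝ)) (by norm_num) (by norm_num) (by norm_num)
      rwa [← smul_add, ← sub_eq_add_neg] at this
    · have h3 : dist a b ≤ 2 * l := by
        have := dist_triangle_right a b x
        rw [mem_closedBall] at ha' hb'
        linarith
      rw [dist_eq_norm] at h3
      rw [mem_closedBall, dist_zero_right, norm_smul]
      norm_num
      linarith
  have h2 : volume.real K ≤ t.card * volume.real (K ∩ closedBall 0 l) := by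
    have e : K ⊆ ⋃ x ∈ t, K ∩ closedBall x l := by
      intro z hz
      obtain ⟨x, hx, hzx⟩ := mem_iUnion₂.1 (ht hz)
      exact mem_iUnion₂.2 ⟨x, hx, hz, hzx⟩
    have hfin2 : volume (⋃ x ∈ t, K ∩ closedBall x l) ≠ ⊤ :=
      ((measure_mono (iUnion₂_subset fun x _ => inter_subset_left)).trans_lt hK.measure_lt_top).ne
    calc volume.real K ≤ volume.real (⋃ x ∈ t, K ∩ closedBall x l) := measureReal_mono e hfin2
      _ ≤ ∑ x ∈ t, volume.real (K ∩ closedBall x l) := measureReal_biUnion_finset_le _ _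
      _ ≤ ∑ x ∈ t, volume.real (K ∩ closedBall 0 l) := Finset.sum_le_sum h1
      _ = _ := by simp
  have hq : 0 ≤ ρ / l := by positivity
  have hq1 : ρ / l ≤ 1 := (div_le_one hl).2 hρl
  have h3 : (ρ / l) ^ n * volume.real (K ∩ closedBall 0 l) ≤ volume.real (K ∩ closedBall 0 ρ) := by
    have e : (ρ / l) • (K ∩ closedBall 0 l) ⊆ K ∩ closedBall 0 ρ := by
      rintro _ ⟨a, ⟨ha, ha'⟩, rfl⟩
      refine ⟨hc.smul_mem_of_zero_mem h0 ha ⟨hq, hq1⟩, ?_⟩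
      simp only [mem_closedBall, dist_zero_right] at ha' ⊢
      rw [norm_smul, Real.norm_of_nonneg hq]
      calc ρ / l * ‖a‖ ≤ ρ / l * l := by gcongr
        _ = ρ := by field_simp
    have := measureReal_mono (μ := volume) e (hfin _)
    rw [measureReal_def, Measure.addHaar_smul, ENNReal.toReal_mul,
      ENNReal.toReal_ofReal (abs_nonneg _), abs_of_nonneg (pow_nonneg hq _)] at this
    simpa [measureReal_def] using this
  calc (ρ / l) ^ n * volume.real K
      ≤ (ρ / l) ^ n * (t.card * volume.real (K ∩ closedBall 0 l)) := by gcongr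
    _ = t.card * ((ρ / l) ^ n * volume.real (K ∩ closedBall 0 l)) := by ring
    _ ≤ _ := mul_le_mul_of_nonneg_left h3 (Nat.cast_nonneg _)

/-- Lemma 5.1: for a symmetric convex body `K` in `ℝ^n` and `r, r₁ > 0`, setting
`K_r = K ∩ rD_n` and `K^{r₁} = co(K ∪ r₁D_n)`, one has
(i) `N_{K_r} ≤ max {3^n N_K², 9^n N_K}` and (ii) `N_{K^{r₁}} ≤ 5^n N_K`. -/
theorem NcovK_inter_ball_le_and_NcovK_hull_le :
    ∀ (n : ℕ) (K : Set (EuclideanSpace ℝ (Fin n))), IsSymmetricConvexBody K →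
      ∀ r r₁ : ℝ, 0 < r → 0 < r₁ →
        NcovK (K ∩ r • closedBall (0 : EuclideanSpace ℝ (Fin n)) 1) ≤
            max (3 ^ n * NcovK K ^ 2) (9 ^ n * NcovK K) ∧
          NcovK (convexHull ℝ
              (K ∪ r₁ • closedBall (0 : EuclideanSpace ℝ (Fin n)) 1)) ≤
            5 ^ n * NcovK K := by
  intro n K hKK r r₁ hr hr₁
  obtain ⟨hc, hK, hint, hs⟩ := hKK
  have hne : K.Nonempty := hint.mono interior_subset
  have h0 : (0 : EuclideanSpace ℝ (Fin n)) ∈ K := by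
    obtain ⟨a, ha⟩ := hne
    have hb : -a ∈ K := by rw [hs]; simpa using ha
    have := hc ha hb (a := (2⁻¹ : ℝ)) (b := (2⁻¹ : ℝ)) (by norm_num) (by norm_num) (by norm_num)
    simpa using this
  rw [smul_unitClosedBall_of_nonneg hr.le, smul_unitClosedBall_of_nonneg hr₁.le]
  rcases Nat.eq_zero_or_pos n with rfl | hn
  · have h1 : ∀ S : Set (EuclideanSpace ℝ (Fin 0)), volRadius S = 1 := by
      intro S; simp [volRadius]
    have h2 : ∀ S : Set (EuclideanSpace ℝ (Fin 0)), NcovK S ≤ 1 := by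
      intro S
      refine Nat.sInf_le ⟨{0}, by simp, ?_⟩
      intro z _
      rw [h1]
      simp only [vadd_smul_ball _ zero_le_one]
      simp [Subsingleton.elim z 0]
    have h3 : 1 ≤ NcovK K := Ncov_pos hK hne (by rw [h1]; norm_num)
    refine ⟨(h2 _).trans (le_max_of_le_right ?_), (h2 _).trans ?_⟩ <;> simpa using h3
  have hn' : n ≠ 0 := hn.ne'
  have hvK : 0 < volume.real K :=
    ENNReal.toReal_pos (Measure.measure_pos_of_nonempty_interior _ hint).ne' hK.measure_lt_top.ne
  have hV := vol_unit_pos (n := n)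
  obtain ⟨-, hl2⟩ := volRadius_pow hn' K
  have hl := volRadius_pos hn' hvK
  have hN := Ncov_pos hK hne hl
  obtain ⟨t, htc, ht⟩ := cov_attained hK hl
  set l := volRadius K with hldef
  have hN' : (1 : ℝ) ≤ NcovK K := by exact_mod_cast hN
  constructor
  · refine le_max_of_le_left ?_
    set A := K ∩ closedBall (0 : EuclideanSpace ℝ (Fin n)) r with hA
    have hAfin : volume A ≠ ⊤ := ((measure_mono inter_subset_left).trans_lt hK.measure_lt_top).ne
    set ρ := min r l with hρ
    have hρ0 : 0 < ρ := lt_min hr hl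
    have h1 := inter_vol hc hK h0 hs hl hρ0 (min_le_right _ _) t ht
    have h2 : volume.real (K ∩ closedBall 0 ρ) ≤ volume.real A :=
      measureReal_mono (inter_subset_inter_right _ (closedBall_subset_closedBall (min_le_left _ _)))
        hAfin
    have h3 : ρ ^ n * volume.real (closedBall (0 : EuclideanSpace ℝ (Fin n)) 1) ≤
        NcovK K * volume.real A := by
      calc _ = (ρ / l) ^ n * volume.real K := by rw [hl2, div_pow]; field_simp
        _ ≤ _ := h1
        _ ≤ _ := by rw [htc]; gcongr
    have hvA : 0 < volume.real A := by
      by_contra h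
      have h' : volume.real A = 0 := le_antisymm (not_lt.1 h) measureReal_nonneg
      rw [h', mul_zero] at h3
      have : 0 < ρ ^ n * volume.real (closedBall (0 : EuclideanSpace ℝ (Fin n)) 1) := by positivity
      linarith
    have hm := volRadius_pos hn' hvA
    obtain ⟨-, hm2⟩ := volRadius_pow hn' A
    have hml : volRadius A ≤ ρ := by
      refine le_min ?_ (volRadius_mono hn' inter_subset_left hK.measure_lt_top.ne)
      have := volRadius_mono hn' (inter_subset_right : A ⊆ closedBall 0 r)
        measure_closedBall_lt_top.ne
      rwa [volRadius_ball hn' hr.le] at this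
    set m := volRadius A with hmdef
    have h4 : ρ ^ n ≤ NcovK K * m ^ n := by
      rw [hm2, ← mul_assoc] at h3
      exact le_of_mul_le_mul_right h3 hV
    have h5 : (1 + 2 * ρ / m) ^ n ≤ 3 ^ n * NcovK K := by
      calc (1 + 2 * ρ / m) ^ n ≤ (3 * (ρ / m)) ^ n := by
            have : 1 ≤ ρ / m := (one_le_div hm).2 hml
            gcongr
            rw [mul_div_assoc]; linarith
        _ = 3 ^ n * (ρ ^ n / m ^ n) := by rw [mul_pow, div_pow]
        _ ≤ _ := by gcongr; rwa [div_le_iff₀ (by positivity)]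
    have h6 : ∃ t1 : Finset (EuclideanSpace ℝ (Fin n)), t1.card ≤ NcovK K ∧
        A ⊆ ⋃ x ∈ t1, closedBall x ρ := by
      rcases le_total r l with h | h
      · refine ⟨{0}, by simpa using hN, ?_⟩
        rw [hρ, min_eq_left h]
        simp [hA]
      · refine ⟨t, htc.le, ?_⟩
        rw [hρ, min_eq_right h]
        exact inter_subset_left.trans ht
    obtain ⟨t1, ht1, ht1c⟩ := h6
    have h7 := cov_le hρ0.le hm t1 ht1c
    have ht1' : (t1.card : ℝ) ≤ NcovK K := by exact_mod_cast ht1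
    have : (NcovK A : ℝ) ≤ 3 ^ n * NcovK K ^ 2 := by
      calc (NcovK A : ℝ) ≤ _ := h7
        _ ≤ NcovK K * (3 ^ n * NcovK K) := by gcongr
        _ = _ := by ring
    exact_mod_cast this
  · set L := convexHull ℝ (K ∪ closedBall (0 : EuclideanSpace ℝ (Fin n)) r₁) with hL
    have hKL : K ⊆ L := subset_union_left.trans (subset_convexHull ℝ _)
    have hBL : closedBall (0 : EuclideanSpace ℝ (Fin n)) r₁ ⊆ L :=
      subset_union_right.trans (subset_convexHull ℝ _)
    have hLs : L ⊆ K + closedBall (0 : EuclideanSpace ℝ (Fin n)) r₁ := by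
      refine convexHull_min ?_ (hc.add (convex_closedBall _ _))
      rintro z (hz | hz)
      · exact ⟨z, hz, 0, by simp [hr₁.le], by simp⟩
      · exact ⟨0, h0, z, hz, by simp⟩
    have hLfin : volume L ≠ ⊤ := ((measure_mono hLs).trans_lt
      (hK.add (isCompact_closedBall _ _)).measure_lt_top).ne
    have hlm : l ≤ volRadius L := volRadius_mono hn' hKL hLfin
    have hrm : r₁ ≤ volRadius L := by
      have := volRadius_mono hn' hBL hLfin
      rwa [volRadius_ball hn' hr₁.le] at this
    have hm : 0 < volRadius L := hl.trans_le hlm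
    set m := volRadius L with hmdef
    have hcov : L ⊆ ⋃ x ∈ t, closedBall x (2 * m) := by
      intro z hz
      obtain ⟨a, ha, b, hb, rfl⟩ := hLs hz
      obtain ⟨x, hx, hax⟩ := mem_iUnion₂.1 (ht ha)
      refine mem_iUnion₂.2 ⟨x, hx, ?_⟩
      simp only [mem_closedBall, dist_zero_right] at hb hax ⊢
      rw [dist_eq_norm] at hax ⊢
      have := norm_add_le (a - x) b
      rw [show a + b - x = a - x + b by abel]
      linarith
    have h7 := cov_le (by positivity) hm t hcov
    have h8 : 1 + 2 * (2 * m) / m = 5 := by field_simp; norm_num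
    rw [h8, htc] at h7
    have : (NcovK L : ℝ) ≤ 5 ^ n * NcovK K := by
      rw [mul_comm]; exact h7
    exact_mod_cast this
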